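/- The set of elements {e_f·v_1^{r_1}·v_2^{r_2}·…·v_θ^{r_θ} : f ∈ F, 0 ≤ r_i < N_i for each i} is a k-vector space basis of A(V,F,ψ,ξ,α); in particular dim_k A(V,F,ψ,ξ,α) = |F|·N_1·N_2·…·N_θ. -/

import Mathlib

open scoped TensorProduct

noncomputable section

namespace QLSBasis

variable (k : Type) [Field k] [IsAlgClosed k] [CharZero k]
variable (Γ : Type) [CommGroup Γ] [Fintype Γ]
variable (θ : ℕ) (g : Fin θ → Γ) (χ : Fin θ → (Γ →* kˣ)) (N : Fin θ → ℕ)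
variable (F : Subgroup Γ) (ψ : F → F → kˣ) (ξ : Fin θ → k) (α : Fin θ → Fin θ → k)

/-- The relations presenting the comodule algebra `A(V,F,ψ,ξ,α)`:
`e_1 = 1`, `e_f·e_h = ψ(f,h)·e_{fh}`, `e_f·v_i = χ_i(f)·v_i·e_f`,
`v_i·v_j − q_{ij}·v_j·v_i = α_{ij}·e_{g_i g_j}` if `g_i g_j ∈ F` and `= 0`
otherwise (`i < j`), and `v_i^{N_i} = ξ_i·e_{g_i^{N_i}}` if `g_i^{N_i} ∈ F` and
`= 0` otherwise. -/
inductive ARel : FreeAlgebra k (Fin θ ⊕ F) → FreeAlgebra k (Fin θ ⊕ F) → Prop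
  | e_one : ARel (FreeAlgebra.ι k (Sum.inr (1 : F))) 1
  | e_mul (f f' : F) :
      ARel (FreeAlgebra.ι k (Sum.inr f) * FreeAlgebra.ι k (Sum.inr f'))
        ((ψ f f' : k) • FreeAlgebra.ι k (Sum.inr (f * f')))
  | e_v (f : F) (i : Fin θ) :
      ARel (FreeAlgebra.ι k (Sum.inr f) * FreeAlgebra.ι k (Sum.inl i))
        ((χ i (f : Γ) : k) • (FreeAlgebra.ι k (Sum.inl i) * FreeAlgebra.ι k (Sum.inr f)))
  | v_comm_mem (i j : Fin θ) (hij : i < j) (hmem : g i * g j ∈ F) :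
      ARel (FreeAlgebra.ι k (Sum.inl i) * FreeAlgebra.ι k (Sum.inl j)
          - (χ j (g i) : k) • (FreeAlgebra.ι k (Sum.inl j) * FreeAlgebra.ι k (Sum.inl i)))
        (α i j • FreeAlgebra.ι k (Sum.inr ⟨g i * g j, hmem⟩))
  | v_comm_nmem (i j : Fin θ) (hij : i < j) (hnmem : g i * g j ∉ F) :
      ARel (FreeAlgebra.ι k (Sum.inl i) * FreeAlgebra.ι k (Sum.inl j)
          - (χ j (g i) : k) • (FreeAlgebra.ι k (Sum.inl j) * FreeAlgebra.ι k (Sum.inl i))) 0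
  | v_pow_mem (i : Fin θ) (hmem : g i ^ N i ∈ F) :
      ARel (FreeAlgebra.ι k (Sum.inl i) ^ N i)
        (ξ i • FreeAlgebra.ι k (Sum.inr ⟨g i ^ N i, hmem⟩))
  | v_pow_nmem (i : Fin θ) (hnmem : g i ^ N i ∉ F) :
      ARel (FreeAlgebra.ι k (Sum.inl i) ^ N i) 0

/-- The comodule algebra `A(V,F,ψ,ξ,α)`, presented by generators and relations. -/
abbrev A := RingQuot (ARel k Γ θ g χ N F ψ ξ α)

/-- The generator `v i` of `A(V,F,ψ,ξ,α)`. -/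
def v (i : Fin θ) : A k Γ θ g χ N F ψ ξ α :=
  RingQuot.mkAlgHom k (ARel k Γ θ g χ N F ψ ξ α) (FreeAlgebra.ι k (Sum.inl i))

/-- The generator `e f` of `A(V,F,ψ,ξ,α)`. -/
def e (f : F) : A k Γ θ g χ N F ψ ξ α :=
  RingQuot.mkAlgHom k (ARel k Γ θ g χ N F ψ ξ α) (FreeAlgebra.ι k (Sum.inr f))

local notation "Aa" => A k Γ θ g χ N F ψ ξ α
local notation "vv" => v k Γ θ g χ N F ψ ξ α
local notation "ee" => e k Γ θ g χ N F ψ ξ α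

section Helpers

set_option linter.unusedSectionVars false

/-- Gaussian binomials. -/
def gb (q : k) : ℕ → ℕ → k
  | _, 0 => 1
  | 0, _ + 1 => 0
  | n + 1, j + 1 => gb q n j + q ^ (j + 1) * gb q n (j + 1)

theorem gb_zero_right (q : k) (n : ℕ) : gb k q n 0 = 1 := by cases n <;> rfl

theorem gb_succ (q : k) (n j : ℕ) :
    gb k q (n + 1) (j + 1) = gb k q n j + q ^ (j + 1) * gb k q n (j + 1) := rfl

theorem gb_lt (q : k) (n : ℕ) : ∀ j, n < j → gb k q n j = 0 := by
  induction n with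
  | zero => intro j hj; obtain ⟨j, rfl⟩ := Nat.exists_eq_succ_of_ne_zero hj.ne'; rfl
  | succ n ih =>
    intro j hj
    obtain ⟨j, rfl⟩ := Nat.exists_eq_succ_of_ne_zero (Nat.ne_of_gt (Nat.zero_lt_of_lt hj))
    rw [Nat.succ_eq_add_one, gb_succ, ih _ (by omega), ih _ (by omega)]; simp

theorem gb_self (q : k) (n : ℕ) : gb k q n n = 1 := by
  induction n with
  | zero => rfl
  | succ n ih => rw [gb_succ, ih, gb_lt k q n _ (by omega)]; simp

theorem gb_rec (q : k) (n : ℕ) : ∀ j,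
    (q ^ (j + 1) - 1) * gb k q (n + 1) (j + 1) = (q ^ (n + 1) - 1) * gb k q n j := by
  induction n with
  | zero =>
    intro j
    cases j with
    | zero => simp [gb]
    | succ j => simp [gb]
  | succ n ih =>
    intro j
    have h1 := ih j
    rw [gb_succ k q (n + 1) j]
    cases j with
    | zero => 
      simp only [gb_zero_right] at *
      linear_combination q * h1
    | succ j =>
      have h2 := ih j
      have h3 := gb_succ k q n j
      linear_combination q ^ (j + 2) * h1 + q * h2 - q * (q ^ (n + 1) - 1) * h3

theorem gb_vanish (q : k) (n j : ℕ) (hn : q ^ (n + 1) = 1) (hj : q ^ (j + 1) ≠ 1) :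
    gb k q (n + 1) (j + 1) = 0 := by
  have := gb_rec k q n j
  rw [hn, sub_self, zero_mul] at this
  exact (mul_eq_zero.1 this).resolve_left (sub_ne_zero.2 hj)

theorem qbinom {R : Type} [Ring R] [Algebra k R] (q : k) (D S : R) (h : S * D = q • (D * S)) (n : ℕ) :
    (D + S) ^ n = ∑ j ∈ Finset.range (n + 1), gb k q n j • (D ^ j * S ^ (n - j)) := by
  have hS : ∀ j : ℕ, S * D ^ j = q ^ j • (D ^ j * S) := by
    intro j
    induction j with
    | zero => simp
    | succ j ih =>
      rw [pow_succ D, ← mul_assoc, ih, smul_mul_assoc, mul_assoc, h, mul_smul_comm, smul_smul,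
        ← mul_assoc, ← pow_succ, ← pow_succ]
  induction n with
  | zero => simp [gb]
  | succ n ih =>
    rw [pow_succ', ih, add_mul, Finset.mul_sum, Finset.mul_sum, Finset.sum_range_succ' _ (n + 1)]
    have e1 : ∀ j ∈ Finset.range (n + 1), S * gb k q n j • (D ^ j * S ^ (n - j)) =
        (q ^ j * gb k q n j) • (D ^ j * S ^ (n + 1 - j)) := by
      intro j hj
      rw [Finset.mem_range] at hj
      rw [mul_smul_comm, ← mul_assoc, hS, smul_mul_assoc, mul_assoc, ← pow_succ', smul_smul,
        mul_comm (gb k q n j), show n - j + 1 = n + 1 - j by omega]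
    rw [Finset.sum_congr rfl e1]
    simp only [gb_succ, add_smul, Finset.sum_add_distrib]
    rw [add_assoc]
    congr 1
    · refine Finset.sum_congr rfl fun j hj => ?_
      rw [mul_smul_comm, ← mul_assoc, ← pow_succ', Nat.add_sub_add_right]
    · rw [Finset.sum_range_succ' _ n, Finset.sum_range_succ _ n, gb_lt k q n (n + 1) (by omega)]
      simp [gb_zero_right]

theorem qfrobenius {R : Type} [Ring R] [Algebra k R] (q : k) (D S : R)
    (h : S * D = q • (D * S)) (n : ℕ) (hn : 0 < n) (hq : orderOf q = n) :
    (D + S) ^ n = D ^ n + S ^ n := by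
  rw [qbinom k q D S h]
  obtain ⟨n, rfl⟩ := Nat.exists_eq_succ_of_ne_zero hn.ne'
  rw [Finset.sum_range_succ, Finset.sum_range_succ']
  rw [Finset.sum_eq_zero]
  · simp [gb_zero_right, gb_self, add_comm]
  · intro j hj
    rw [Finset.mem_range] at hj
    rw [gb_vanish, zero_smul]
    · rw [← Nat.succ_eq_add_one, ← hq, pow_orderOf_eq_one]
    · intro hh
      have := orderOf_le_of_pow_eq_one (by omega) hh
      omega


theorem solve_aux {R : Type} [Ring R] [Algebra k R] (c : k) (hc : c ≠ 0) (x y w : R)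
    (h : x - y = c • w) : w = c⁻¹ • x + -(c⁻¹ • y) := by
  rw [← sub_eq_add_neg, ← smul_sub, h, smul_smul, inv_mul_cancel₀ hc, one_smul]

open Classical in
/-- Extension of a family indexed by `F` by zero. -/
def extE {R : Type} [Ring R] (E : F → R) (x : Γ) : R :=
  if h : x ∈ F then E ⟨x, h⟩ else 0

/-- A family satisfying the defining relations. -/
structure Rels {R : Type} [Ring R] [Algebra k R] (E : F → R) (V : Fin θ → R) : Prop where
  e_one : E 1 = 1
  e_mul : ∀ f f', E f * E f' = (ψ f f' : k) • E (f * f')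
  e_v : ∀ f i, E f * V i = (χ i (f : Γ) : k) • (V i * E f)
  v_comm : ∀ i j, i < j → V i * V j - (χ j (g i) : k) • (V j * V i) =
    α i j • extE Γ F E (g i * g j)
  v_pow : ∀ i, V i ^ N i = ξ i • extE Γ F E (g i ^ N i)

/-- The hypotheses. -/
structure Good : Prop where
  compat : ∀ i j, i ≠ j → χ i (g j) * χ j (g i) = 1
  hN : ∀ i, N i = orderOf (χ i (g i))
  hN1 : ∀ i, 1 < N i
  hψ : ∀ x y z : F, ψ x y * ψ (x * y) z = ψ y z * ψ x (y * z)
  hψ1 : ∀ x : F, ψ 1 x = 1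
  hψ1' : ∀ x : F, ψ x 1 = 1
  hξ : ∀ i, ξ i = 0 ∨ ∃ hmem : g i ^ N i ∈ F,
      ∀ f : F, (χ i (f : Γ)) ^ N i =
        ψ f ⟨g i ^ N i, hmem⟩ * (ψ ⟨g i ^ N i, hmem⟩ f)⁻¹
  hα : ∀ i j : Fin θ, i < j → (α i j = 0 ∨ ∃ hmem : g i * g j ∈ F,
      ∀ f : F, χ i (f : Γ) * χ j (f : Γ) =
        ψ f ⟨g i * g j, hmem⟩ * (ψ ⟨g i * g j, hmem⟩ f)⁻¹)

theorem A_rels : Rels k Γ θ g χ N F ψ ξ α ee vv where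
  e_one := by
    have := RingQuot.mkAlgHom_rel k (ARel.e_one (k := k) (Γ := Γ) (θ := θ) (g := g) (χ := χ) (N := N)
      (F := F) (ψ := ψ) (ξ := ξ) (α := α))
    simpa [e] using this
  e_mul f f' := by
    have := RingQuot.mkAlgHom_rel k (ARel.e_mul (k := k) (Γ := Γ) (θ := θ) (g := g) (χ := χ) (N := N)
      (F := F) (ψ := ψ) (ξ := ξ) (α := α) f f')
    simpa [map_mul, map_smul, e, v] using this
  e_v f i := by
    have := RingQuot.mkAlgHom_rel k (ARel.e_v (k := k) (Γ := Γ) (θ := θ) (g := g) (χ := χ) (N := N)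
      (F := F) (ψ := ψ) (ξ := ξ) (α := α) f i)
    simpa [map_mul, map_smul, e, v] using this
  v_comm i j hij := by
    by_cases hm : g i * g j ∈ F
    · have := RingQuot.mkAlgHom_rel k (ARel.v_comm_mem (k := k) (Γ := Γ) (θ := θ) (g := g) (χ := χ)
        (N := N) (F := F) (ψ := ψ) (ξ := ξ) (α := α) i j hij hm)
      rw [extE, dif_pos hm]
      simpa [map_mul, map_smul, e, v] using this
    · have := RingQuot.mkAlgHom_rel k (ARel.v_comm_nmem (k := k) (Γ := Γ) (θ := θ) (g := g) (χ := χ)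
        (N := N) (F := F) (ψ := ψ) (ξ := ξ) (α := α) i j hij hm)
      rw [extE, dif_neg hm]
      simpa [map_mul, map_smul, e, v] using this
  v_pow i := by
    by_cases hm : g i ^ N i ∈ F
    · have := RingQuot.mkAlgHom_rel k (ARel.v_pow_mem (k := k) (Γ := Γ) (θ := θ) (g := g) (χ := χ)
        (N := N) (F := F) (ψ := ψ) (ξ := ξ) (α := α) i hm)
      rw [extE, dif_pos hm]
      simpa [map_mul, map_smul, e, v] using this
    · have := RingQuot.mkAlgHom_rel k (ARel.v_pow_nmem (k := k) (Γ := Γ) (θ := θ) (g := g) (χ := χ)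
        (N := N) (F := F) (ψ := ψ) (ξ := ξ) (α := α) i hm)
      rw [extE, dif_neg hm]
      simpa [map_mul, map_smul, e, v] using this

theorem exists_lift {R : Type} [Ring R] [Algebra k R] (E : F → R) (V : Fin θ → R)
    (h : Rels k Γ θ g χ N F ψ ξ α E V) :
    ∃ ρ : Aa →ₐ[k] R, (∀ f, ρ (ee f) = E f) ∧ (∀ i, ρ (vv i) = V i) := by
  let φ : FreeAlgebra k (Fin θ ⊕ F) →ₐ[k] R := FreeAlgebra.lift k (Sum.elim V E)
  have hφ : ∀ ⦃x y⦄, ARel k Γ θ g χ N F ψ ξ α x y → φ x = φ y := by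
    intro x y hxy
    cases hxy with
    | e_one => simpa [φ] using h.e_one
    | e_mul f f' => simpa [φ] using h.e_mul f f'
    | e_v f i => simpa [φ] using h.e_v f i
    | v_comm_mem i j hij hm =>
      have := h.v_comm i j hij
      rw [extE, dif_pos hm] at this
      simpa [φ] using this
    | v_comm_nmem i j hij hm =>
      have := h.v_comm i j hij
      rw [extE, dif_neg hm] at this
      simpa [φ] using this
    | v_pow_mem i hm =>
      have := h.v_pow i
      rw [extE, dif_pos hm] at this
      simpa [φ] using this
    | v_pow_nmem i hm =>
      have := h.v_pow i
      rw [extE, dif_neg hm] at this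
      simpa [φ] using this
  refine ⟨RingQuot.liftAlgHom k ⟨φ, hφ⟩, fun f => ?_, fun i => ?_⟩
  · rw [e, RingQuot.liftAlgHom_mkAlgHom_apply]; simp [φ]
  · rw [v, RingQuot.liftAlgHom_mkAlgHom_apply]; simp [φ]

theorem left_ideal_top (W : Submodule k Aa) (h1 : (1 : Aa) ∈ W)
    (he : ∀ f, ∀ w ∈ W, ee f * w ∈ W) (hv : ∀ i, ∀ w ∈ W, vv i * w ∈ W) : W = ⊤ := by
  have key : ∀ y : FreeAlgebra k (Fin θ ⊕ F), ∀ w ∈ W,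
      RingQuot.mkAlgHom k (ARel k Γ θ g χ N F ψ ξ α) y * w ∈ W := by
    intro y
    induction y using FreeAlgebra.induction with
    | grade0 r =>
      intro w hw
      rw [AlgHom.commutes, ← Algebra.smul_def]
      exact W.smul_mem _ hw
    | grade1 x =>
      intro w hw
      cases x with
      | inl i => exact hv i w hw
      | inr f => exact he f w hw
    | mul a b ha hb =>
      intro w hw
      rw [map_mul, mul_assoc]
      exact ha _ (hb _ hw)
    | add a b ha hb =>
      intro w hw
      rw [map_add, add_mul]
      exact W.add_mem (ha _ hw) (hb _ hw)
  rw [eq_top_iff]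
  intro x _
  obtain ⟨y, rfl⟩ := RingQuot.mkAlgHom_surjective k (ARel k Γ θ g χ N F ψ ξ α) x
  simpa using key y 1 h1

theorem Good.castSucc {n : ℕ} {g : Fin (n + 1) → Γ} {χ : Fin (n + 1) → (Γ →* kˣ)}
    {N : Fin (n + 1) → ℕ} {ξ : Fin (n + 1) → k} {α : Fin (n + 1) → Fin (n + 1) → k}
    (h : Good k Γ (n + 1) g χ N F ψ ξ α) :
    Good k Γ n (fun i => g i.castSucc) (fun i => χ i.castSucc) (fun i => N i.castSucc) F ψ
      (fun i => ξ i.castSucc) (fun i j => α i.castSucc j.castSucc) where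
  compat i j hij := h.compat _ _ (by simpa using hij)
  hN i := h.hN _
  hN1 i := h.hN1 _
  hψ := h.hψ
  hψ1 := h.hψ1
  hψ1' := h.hψ1'
  hξ i := h.hξ _
  hα i j hij := h.hα _ _ (by simpa using hij)

theorem Rels.castSucc {n : ℕ} {g : Fin (n + 1) → Γ} {χ : Fin (n + 1) → (Γ →* kˣ)}
    {N : Fin (n + 1) → ℕ} {ξ : Fin (n + 1) → k} {α : Fin (n + 1) → Fin (n + 1) → k}
    {R : Type} [Ring R] [Algebra k R] {E : F → R} {V : Fin (n + 1) → R}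
    (h : Rels k Γ (n + 1) g χ N F ψ ξ α E V) :
    Rels k Γ n (fun i => g i.castSucc) (fun i => χ i.castSucc) (fun i => N i.castSucc) F ψ
      (fun i => ξ i.castSucc) (fun i j => α i.castSucc j.castSucc) E (fun i => V i.castSucc) where
  e_one := h.e_one
  e_mul := h.e_mul
  e_v f i := h.e_v f _
  v_comm i j hij := h.v_comm _ _ (by simpa using hij)
  v_pow i := h.v_pow _

/-- The PBW monomials. -/
def mono (p : F × (∀ i : Fin θ, Fin (N i))) : Aa :=
  ee p.1 * ((List.finRange θ).map fun i => vv i ^ (p.2 i : ℕ)).prod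

theorem span_zero (g : Fin 0 → Γ) (χ : Fin 0 → (Γ →* kˣ))
    (N : Fin 0 → ℕ) (ξ : Fin 0 → k) (α : Fin 0 → Fin 0 → k) :
    Submodule.span k (Set.range (mono k Γ 0 g χ N F ψ ξ α)) = ⊤ := by
  have hr := A_rels k Γ 0 g χ N F ψ ξ α
  have hm : ∀ p, mono k Γ 0 g χ N F ψ ξ α p = e k Γ 0 g χ N F ψ ξ α p.1 := by
    intro p; simp [mono]
  have hmem : ∀ f, e k Γ 0 g χ N F ψ ξ α f ∈ 
      Submodule.span k (Set.range (mono k Γ 0 g χ N F ψ ξ α)) := fun f => 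
    Submodule.subset_span ⟨(f, fun i => i.elim0), hm _⟩
  apply left_ideal_top
  · rw [← hr.e_one]; exact hmem _
  · intro f w hw
    induction hw using Submodule.span_induction with
    | mem x hx =>
      obtain ⟨p, rfl⟩ := hx
      rw [hm, hr.e_mul]
      exact Submodule.smul_mem _ _ (hmem _)
    | zero => simp
    | add x y _ _ hx hy => rw [mul_add]; exact Submodule.add_mem _ hx hy
    | smul c x _ hx => rw [mul_smul_comm]; exact Submodule.smul_mem _ _ hx
  · intro i; exact i.elim0

theorem span_succ (n : ℕ) (g : Fin (n + 1) → Γ) (χ : Fin (n + 1) → (Γ →* kˣ))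
    (N : Fin (n + 1) → ℕ) (ξ : Fin (n + 1) → k) (α : Fin (n + 1) → Fin (n + 1) → k)
    (h : Good k Γ (n + 1) g χ N F ψ ξ α)
    (ih : Submodule.span k (Set.range (mono k Γ n (fun i => g i.castSucc) (fun i => χ i.castSucc)
      (fun i => N i.castSucc) F ψ (fun i => ξ i.castSucc)
      (fun i j => α i.castSucc j.castSucc))) = ⊤) :
    Submodule.span k (Set.range (mono k Γ (n + 1) g χ N F ψ ξ α)) = ⊤ := by
  have hr := A_rels k Γ (n + 1) g χ N F ψ ξ α
  obtain ⟨j, hje, hjv⟩ := exists_lift k Γ n _ _ _ F ψ _ _ _ _ hr.castSucc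
  set T := Submodule.span k (Set.range (mono k Γ (n + 1) g χ N F ψ ξ α)) with hT
  set x := v k Γ (n + 1) g χ N F ψ ξ α (Fin.last n) with hx
  -- products lie in the span
  have hmem : ∀ b, ∀ r < N (Fin.last n), j b * x ^ r ∈ T := by
    intro b r hrN
    have hb : b ∈ Submodule.span k (Set.range (mono k Γ n (fun i => g i.castSucc)
      (fun i => χ i.castSucc) (fun i => N i.castSucc) F ψ (fun i => ξ i.castSucc)
      (fun i j => α i.castSucc j.castSucc))) := by rw [ih]; trivial
    induction hb using Submodule.span_induction with
    | mem y hy =>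
      obtain ⟨p, rfl⟩ := hy
      refine Submodule.subset_span ⟨(p.1, Fin.lastCases ⟨r, hrN⟩ p.2), ?_⟩
      simp [mono, List.finRange_succ_last, hje, hjv, mul_assoc, map_list_prod, Function.comp_def, hx]
    | zero => simp
    | add y z _ _ hy hz => rw [map_add, add_mul]; exact T.add_mem hy hz
    | smul c y _ hy => rw [map_smul, smul_mul_assoc]; exact T.smul_mem _ hy
  -- closure under the last variable
  have hcomm : ∀ b, ∃ b1 b2, x * j b = j b1 * x + j b2 := by
    let W : Submodule k (A k Γ n (fun i => g i.castSucc) (fun i => χ i.castSucc)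
      (fun i => N i.castSucc) F ψ (fun i => ξ i.castSucc) (fun i j => α i.castSucc j.castSucc)) :=
      { carrier := {b | ∃ b1 b2, x * j b = j b1 * x + j b2}
        zero_mem' := ⟨0, 0, by simp⟩
        add_mem' := by
          rintro a b ⟨a1, a2, ha⟩ ⟨b1, b2, hb⟩
          refine ⟨a1 + b1, a2 + b2, ?_⟩
          rw [map_add, mul_add, ha, hb, map_add, map_add, add_mul]; abel
        smul_mem' := by
          rintro c b ⟨b1, b2, hb⟩
          refine ⟨c • b1, c • b2, ?_⟩
          rw [map_smul, mul_smul_comm, hb, map_smul, map_smul, smul_add, smul_mul_assoc] }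
    have hmul : ∀ a b, a ∈ W → b ∈ W → a * b ∈ W := by
      rintro a b ⟨a1, a2, ha⟩ ⟨b1, b2, hb⟩
      refine ⟨a1 * b1, a1 * b2 + a2 * b, ?_⟩
      rw [map_mul, ← mul_assoc, ha, add_mul, mul_assoc, hb]
      simp only [map_mul, map_add, mul_add, mul_assoc, add_assoc]
    have hW : W = ⊤ := by
      apply left_ideal_top
      · exact ⟨1, 0, by simp⟩
      · intro f w hw
        refine hmul _ _ ⟨((χ (Fin.last n) (f : Γ) : k)⁻¹) • e _ _ _ _ _ _ _ _ _ _ f, 0, ?_⟩ hw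
        rw [map_smul, hje, map_zero, add_zero, smul_mul_assoc, hr.e_v, smul_smul,
          inv_mul_cancel₀ (Units.ne_zero _), one_smul]
      · intro i w hw
        have h1 := hr.v_comm i.castSucc (Fin.last n) (Fin.castSucc_lt_last i)
        obtain ⟨b, hb⟩ : ∃ b, j b = α i.castSucc (Fin.last n) • extE Γ F
            (e k Γ (n + 1) g χ N F ψ ξ α) (g i.castSucc * g (Fin.last n)) := by
          by_cases hm : g i.castSucc * g (Fin.last n) ∈ F
          · exact ⟨α i.castSucc (Fin.last n) • e _ _ _ _ _ _ _ _ _ _ ⟨_, hm⟩, by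
              rw [map_smul, hje, extE, dif_pos hm]⟩
          · exact ⟨0, by rw [extE, dif_neg hm]; simp⟩
        replace h1 := (sub_eq_iff_eq_add.2 ((sub_eq_iff_eq_add.1 (h1.trans hb.symm)).trans
          (add_comm _ _)))
        refine hmul _ _ ⟨((χ (Fin.last n) (g i.castSucc) : k)⁻¹) • v _ _ _ _ _ _ _ _ _ _ i,
          -(((χ (Fin.last n) (g i.castSucc) : k)⁻¹) • b), ?_⟩ hw
        rw [map_neg, map_smul, map_smul, hjv, smul_mul_assoc]
        exact solve_aux k _ (Units.ne_zero _) _ _ _ h1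
    intro b
    have : b ∈ W := by rw [hW]; trivial
    exact this
  obtain ⟨c, hc⟩ : ∃ c, j c = x ^ N (Fin.last n) := by
    rw [hx, hr.v_pow]
    by_cases hm : g (Fin.last n) ^ N (Fin.last n) ∈ F
    · exact ⟨ξ (Fin.last n) • e _ _ _ _ _ _ _ _ _ _ ⟨_, hm⟩, by
              rw [map_smul, hje, extE, dif_pos hm]⟩
    · exact ⟨0, by rw [extE, dif_neg hm]; simp⟩
  have hN1 := h.hN1 (Fin.last n)
  have hgen : ∀ w ∈ T, ∃ l : Fin (N (Fin.last n)) → _, w = ∑ r, j (l r) * x ^ (r : ℕ) := by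
    intro w hw
    induction hw using Submodule.span_induction with
    | mem y hy =>
      obtain ⟨p, rfl⟩ := hy
      refine ⟨Pi.single (p.2 (Fin.last n)) (mono k Γ n _ _ _ F ψ _ _ (p.1, fun i => p.2 i.castSucc)), ?_⟩
      rw [Finset.sum_eq_single (p.2 (Fin.last n))]
      · simp [mono, List.finRange_succ_last, hje, hjv, mul_assoc, map_list_prod, Function.comp_def, hx]
      · intro r _ hr; simp [Pi.single_eq_of_ne hr]
      · simp
    | zero => exact ⟨0, by simp⟩
    | add y z _ _ hy hz =>
      obtain ⟨l, rfl⟩ := hy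
      obtain ⟨m, rfl⟩ := hz
      exact ⟨l + m, by simp [add_mul, Finset.sum_add_distrib]⟩
    | smul c y _ hy =>
      obtain ⟨l, rfl⟩ := hy
      exact ⟨c • l, by simp [Finset.smul_sum]⟩
  have hleft : ∀ b, ∀ w ∈ T, j b * w ∈ T := by
    intro b w hw
    obtain ⟨l, rfl⟩ := hgen w hw
    rw [Finset.mul_sum]
    refine T.sum_mem fun r _ => ?_
    rw [← mul_assoc, ← map_mul]
    exact hmem _ _ r.2
  apply left_ideal_top
  · simpa using hmem 1 0 (by omega)
  · intro f w hw
    rw [← hje]; exact hleft _ _ hw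
  · intro i w hw
    induction i using Fin.lastCases with
    | cast i => rw [← hjv]; exact hleft _ _ hw
    | last =>
      obtain ⟨l, rfl⟩ := hgen w hw
      rw [Finset.mul_sum]
      refine T.sum_mem fun r _ => ?_
      rw [← mul_assoc, ← hx]
      obtain ⟨b1, b2, hb⟩ := hcomm (l r)
      rw [hb, add_mul, mul_assoc, ← pow_succ']
      refine T.add_mem ?_ (hmem _ _ r.2)
      by_cases hrN : (r : ℕ) + 1 < N (Fin.last n)
      · exact hmem _ _ hrN
      · have : (r : ℕ) + 1 = N (Fin.last n) := by have := r.2; omega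
        rw [this, ← hc, ← map_mul]
        simpa using hmem (b1 * c) 0 (by omega)


section Ops
variable {B : Type} [Ring B] [Algebra k B]

/-- Diagonal operator. -/
def opD (s : k) (x : B) : Module.End k (ℕ → B) where
  toFun u t := s ^ t • (x * u t)
  map_add' u w := by ext t; simp [mul_add]
  map_smul' r u := by ext t; simp [smul_smul, mul_comm]

/-- Backward weighted shift. -/
def opS (d : ℕ → k) (a : B) : Module.End k (ℕ → B) where
  toFun u t := d t • (a * u (t - 1))
  map_add' u w := by ext t; simp [mul_add]
  map_smul' r u := by ext t; simp [smul_smul, mul_comm]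

/-- Shift. -/
def opT : Module.End k (ℕ → B) where
  toFun u t := u (t + 1)
  map_add' _ _ := rfl
  map_smul' _ _ := rfl

theorem opD_apply (s : k) (x : B) (u : ℕ → B) (t : ℕ) : opD k s x u t = s ^ t • (x * u t) := rfl
theorem opS_apply (d : ℕ → k) (x : B) (u : ℕ → B) (t : ℕ) :
    opS k d x u t = d t • (x * u (t - 1)) := rfl
theorem opT_apply (u : ℕ → B) (t : ℕ) : opT k u t = u (t + 1) := rfl

theorem opT_pow (m : ℕ) (u : ℕ → B) (t : ℕ) : ((opT k) ^ m) u t = u (t + m) := by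
  induction m generalizing t with
  | zero => simp
  | succ m ih => rw [pow_succ', Module.End.mul_apply, opT_apply, ih]; congr 1; omega

theorem opD_pow (s : k) (x : B) (m : ℕ) : (opD k s x) ^ m = opD k (s ^ m) (x ^ m) := by
  ext u t
  induction m with
  | zero => simp [opD_apply]
  | succ m ih =>
    rw [pow_succ', Module.End.mul_apply, opD_apply, ih, opD_apply, opD_apply, mul_smul_comm,
      smul_smul, ← mul_assoc, ← pow_succ', ← mul_pow, ← pow_succ']

theorem opD_mul (s s' r : k) (x x' z : B) (h : x * x' = r • z) :
    opD k s x * opD k s' x' = r • opD k (s * s') z := by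
  ext u t
  simp only [Module.End.mul_apply, LinearMap.smul_apply, Pi.smul_apply, opD_apply, mul_smul_comm,
    smul_smul, ← mul_assoc, h, smul_mul_assoc]
  congr 1; ring

theorem op_ev (s r Q ci : k) (ef vi ai : B) (d : ℕ → k) (hs : s * r = 1) (hd : d 0 = 0)
    (h1 : ef * vi = ci • (vi * ef)) (h2 : ef * ai = (ci * r) • (ai * ef)) :
    opD k s ef * (opD k Q vi + opS k d ai) =
      ci • ((opD k Q vi + opS k d ai) * opD k s ef) := by
  have h1' : ∀ y, ef * (vi * y) = ci • (vi * (ef * y)) := fun y => by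
    rw [← mul_assoc, h1, smul_mul_assoc, mul_assoc]
  have h2' : ∀ y, ef * (ai * y) = (ci * r) • (ai * (ef * y)) := fun y => by
    rw [← mul_assoc, h2, smul_mul_assoc, mul_assoc]
  ext u t
  simp only [Module.End.mul_apply, LinearMap.smul_apply, LinearMap.add_apply, Pi.add_apply,
    Pi.smul_apply, opD_apply, opS_apply, mul_smul_comm, mul_add, smul_add, smul_smul, h1', h2']
  congr 1
  · congr 1; ring
  · cases t with
    | zero => simp [hd]
    | succ t =>
      congr 1
      simp only [Nat.add_sub_cancel]
      rw [pow_succ]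
      linear_combination (s ^ t * d (t + 1) * ci) * hs

theorem op_eT (s r : k) (ef : B) (hs : s * r = 1) :
    opD k s ef * opT k = r • (opT k * opD k s ef) := by
  ext u t
  simp only [Module.End.mul_apply, LinearMap.smul_apply, Pi.smul_apply, opD_apply, opT_apply,
    smul_smul]
  congr 1
  rw [pow_succ]
  linear_combination (-s ^ t) * hs

/-- bracket -/
def br (p : k) (t : ℕ) : k := ∑ b ∈ Finset.range t, p ^ b

theorem br_zero (p : k) : br k p 0 = 0 := by simp [br]
theorem br_succ (p : k) (t : ℕ) : br k p (t + 1) = br k p t + p ^ t := Finset.sum_range_succ _ _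
theorem br_mul (p : k) (t : ℕ) : (p - 1) * br k p t = p ^ t - 1 := mul_geom_sum _ _

theorem br_add (p : k) (hp : p ≠ 1) (m : ℕ) (hm : p ^ m = 1) (t : ℕ) :
    br k p (t + m) = br k p t := by
  apply mul_left_cancel₀ (sub_ne_zero.2 hp)
  rw [br_mul, br_mul, pow_add, hm, mul_one]

theorem br_mod (p : k) (hp : p ≠ 1) (m : ℕ) (hm : p ^ m = 1) (t : ℕ) (ht : t % m = 0) :
    br k p t = 0 := by
  obtain ⟨l, rfl⟩ := Nat.dvd_of_mod_eq_zero ht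
  apply mul_left_cancel₀ (sub_ne_zero.2 hp)
  rw [br_mul, pow_mul, hm]; simp

theorem op_vT (q Q p : k) (vi ai : B) (hqQ : q * Q = 1) :
    (opD k Q vi + opS k (fun t => -Q ^ t * br k p t) ai) * opT k -
      q • (opT k * (opD k Q vi + opS k (fun t => -Q ^ t * br k p t) ai)) =
    opD k (Q * p) ai := by
  ext u t
  simp only [Module.End.mul_apply, LinearMap.smul_apply, LinearMap.add_apply, LinearMap.sub_apply,
    Pi.add_apply, Pi.sub_apply,
    Pi.smul_apply, opD_apply, opS_apply, opT_apply, smul_add, smul_smul,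
    Nat.add_sub_cancel]
  have e1 : q * Q ^ (t + 1) = Q ^ t := by rw [pow_succ]; linear_combination Q ^ t * hqQ
  have e2 : q * (-Q ^ (t + 1) * br k p (t + 1)) = - Q ^ t * (br k p t + p ^ t) := by
    rw [br_succ]
    linear_combination (-(br k p t + p ^ t)) * e1
  rw [e1, e2]
  cases t with
  | zero => simp [br_zero]
  | succ t =>
    simp only [Nat.add_sub_cancel]
    rw [mul_pow]
    module

theorem op_vv (q q' Qi Qj p : k) (vi vj ai aj z : B) (hq : q * q' = 1)
    (h0 : vi * vj - q • (vj * vi) = z)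
    (h1 : aj * vi = (q' * Qi) • (vi * aj)) (h2 : ai * vj = (q * Qj) • (vj * ai))
    (h3 : ∀ t, (br k p (t + 1) * br k p t) • (ai * aj) = 0)
    (h4 : ∀ t, (br k p (t + 1) * br k p t) • (aj * ai) = 0) :
    (opD k Qi vi + opS k (fun t => -Qi ^ t * br k p t) ai) *
      (opD k Qj vj + opS k (fun t => -Qj ^ t * br k p t) aj) -
    q • ((opD k Qj vj + opS k (fun t => -Qj ^ t * br k p t) aj) *
      (opD k Qi vi + opS k (fun t => -Qi ^ t * br k p t) ai)) =
    opD k (Qi * Qj) z := by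
  subst h0
  have h1' : ∀ y, aj * (vi * y) = (q' * Qi) • (vi * (aj * y)) := fun y => by
    rw [← mul_assoc, h1, smul_mul_assoc, mul_assoc]
  have h2' : ∀ y, ai * (vj * y) = (q * Qj) • (vj * (ai * y)) := fun y => by
    rw [← mul_assoc, h2, smul_mul_assoc, mul_assoc]
  ext u t
  simp only [Module.End.mul_apply, LinearMap.smul_apply, LinearMap.add_apply, LinearMap.sub_apply,
    Pi.add_apply, Pi.sub_apply, sub_mul, smul_mul_assoc, mul_assoc,
    Pi.smul_apply, opD_apply, opS_apply, mul_smul_comm, mul_add, smul_add, smul_sub, smul_smul,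
    h1', h2']
  cases t with
  | zero => simp [br_zero]
  | succ t =>
    simp only [Nat.add_sub_cancel]
    have e3 : (-Qi ^ (t + 1) * (br k p (t + 1) * (-Qj ^ t * br k p t))) • (ai * (aj * u (t - 1))) = 0 := by
      rw [← mul_assoc ai, show (-Qi ^ (t + 1) * (br k p (t + 1) * (-Qj ^ t * br k p t))) =
        (Qi ^ (t + 1) * Qj ^ t) * (br k p (t + 1) * br k p t) by ring, ← smul_smul,
        ← smul_mul_assoc, h3]; simp
    have e4 : (q * (-Qj ^ (t + 1) * (br k p (t + 1) * (-Qi ^ t * br k p t)))) • (aj * (ai * u (t - 1))) = 0 := by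
      rw [← mul_assoc aj, show (q * (-Qj ^ (t + 1) * (br k p (t + 1) * (-Qi ^ t * br k p t)))) =
        (q * Qj ^ (t + 1) * Qi ^ t) * (br k p (t + 1) * br k p t) by ring, ← smul_smul,
        ← smul_mul_assoc, h4]; simp
    rw [e3, e4]
    have e5 : q * (-Qj ^ (t + 1) * (br k p (t + 1) * (Qi ^ t * (q' * Qi)))) =
        Qi ^ (t + 1) * (-Qj ^ (t + 1) * br k p (t + 1)) := by
      rw [pow_succ Qi]
      linear_combination (-Qj ^ (t + 1) * br k p (t + 1) * Qi ^ t * Qi) * hq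
    rw [e5, mul_pow]
    match_scalars <;> ring

theorem opS_pow_zero (d : ℕ → k) (a : B) (m : ℕ) (hm : 0 < m) (hd : ∀ t, t % m = 0 → d t = 0) :
    (opS k d a) ^ m = 0 := by
  have key : ∀ l (u : ℕ → B) t, t % m < l → ((opS k d a) ^ l) u t = 0 := by
    intro l
    induction l with
    | zero => intro u t h; omega
    | succ l ih =>
      intro u t h
      rw [pow_succ', Module.End.mul_apply, opS_apply]
      by_cases h0 : t % m = 0
      · rw [hd t h0, zero_smul]
      · rw [ih, mul_zero, smul_zero]
        have ht : t = m * (t / m) + t % m := (Nat.div_add_mod t m).symm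
        have : (t - 1) % m = t % m - 1 := by
          have h5 : t - 1 = (t % m - 1) + m * (t / m) := by omega
          rw [h5, Nat.add_mul_mod_self_left, Nat.mod_eq_of_lt]
          have := Nat.mod_lt t hm
          omega
        omega
  ext u t
  simpa using key m u t (Nat.mod_lt t hm)

theorem op_vpow (qi Qi p : k) (vi ai : B) (m : ℕ) (hm : 0 < m) (hq : orderOf qi = m)
    (h1 : ai * vi = (qi * Qi) • (vi * ai))
    (h2 : ai = 0 ∨ ∀ t, t % m = 0 → br k p t = 0) :
    (opD k Qi vi + opS k (fun t => -Qi ^ t * br k p t) ai) ^ m = opD k (Qi ^ m) (vi ^ m) := by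
  have h1' : ∀ y, ai * (vi * y) = (qi * Qi) • (vi * (ai * y)) := fun y => by
    rw [← mul_assoc, h1, smul_mul_assoc, mul_assoc]
  rw [qfrobenius k qi _ _ _ m hm hq, opD_pow, add_eq_left]
  · rcases h2 with rfl | h2
    · have : opS k (fun t => -Qi ^ t * br k p t) (0 : B) = 0 := by
        ext u t; simp [opS_apply]
      rw [this, zero_pow hm.ne']
    · apply opS_pow_zero k _ _ m hm
      intro t ht
      simp [h2 t ht]
  · ext u t
    simp only [Module.End.mul_apply, LinearMap.smul_apply, Pi.smul_apply, opD_apply, opS_apply,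
      mul_smul_comm, smul_smul, h1']
    cases t with
    | zero => simp [br_zero]
    | succ t =>
      simp only [Nat.add_sub_cancel]
      congr 1; ring

/-- Twisted periodic functions. -/
def perM (m : ℕ) (c : B) : Submodule k (ℕ → B) where
  carrier := {u | ∀ t, u (t + m) = c * u t}
  zero_mem' := by intro t; simp
  add_mem' := by intro u w hu hw t; simp [hu t, hw t, mul_add]
  smul_mem' := by intro r u hu t; simp [hu t]

theorem opD_per (m : ℕ) (c : B) (s r : k) (x : B) (hs : s ^ m * r = 1) (h : x * c = r • (c * x)) :
    ∀ u ∈ perM k m c, opD k s x u ∈ perM k m c := by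
  intro u hu t
  rw [opD_apply, opD_apply, hu t, ← mul_assoc, h, smul_mul_assoc, smul_smul, mul_smul_comm,
    mul_assoc]
  congr 1
  rw [pow_add]
  linear_combination s ^ t * hs

theorem opT_per (m : ℕ) (c : B) :
    ∀ u ∈ perM k m c, opT k u ∈ perM k m c := by
  intro u hu t
  rw [opT_apply, opT_apply, ← hu]; congr 1; omega

theorem opS_per (m : ℕ) (c : B) (Q p r : k) (hp : p ≠ 1) (hm : p ^ m = 1) (a : B)
    (hs : Q ^ m * r = 1) (h : a * c = r • (c * a)) :
    ∀ u ∈ perM k m c, opS k (fun t => -Q ^ t * br k p t) a u ∈ perM k m c := by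
  intro u hu t
  rw [opS_apply, opS_apply]
  rw [br_add k p hp m hm]
  cases t with
  | zero => simp [br_zero]
  | succ t =>
    have := hu t
    rw [show t + 1 + m - 1 = t + m by omega, hu t, ← mul_assoc, h, smul_mul_assoc, smul_smul,
      mul_smul_comm, mul_assoc c a, Nat.add_sub_cancel]
    congr 1
    rw [pow_add _ _ m]
    linear_combination (-Q ^ (t + 1) * br k p (t + 1)) * hs

end Ops

section Commute
variable {k Γ θ g χ N F ψ ξ α}
variable {B : Type} [Ring B] [Algebra k B] {E : F → B} {V : Fin θ → B}

theorem Rels.ext_v (hr : Rels k Γ θ g χ N F ψ ξ α E V) (x : Γ) (i : Fin θ) :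
    extE Γ F E x * V i = (χ i x : k) • (V i * extE Γ F E x) := by
  unfold extE
  split_ifs with h
  · exact hr.e_v ⟨x, h⟩ i
  · simp

theorem Rels.e_e (hr : Rels k Γ θ g χ N F ψ ξ α E V) (f f' : F) (s : kˣ)
    (hs : s = ψ f f' * (ψ f' f)⁻¹) : E f * E f' = (s : k) • (E f' * E f) := by
  rw [hr.e_mul, hr.e_mul, smul_smul, mul_comm f' f, ← Units.val_mul, hs]
  simp

theorem e_smul (hr : Rels k Γ θ g χ N F ψ ξ α E V) (c : k) (x : Γ) (s : F → kˣ)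
    (hc : c = 0 ∨ ∃ hm : x ∈ F, ∀ f : F, s f = ψ f ⟨x, hm⟩ * (ψ ⟨x, hm⟩ f)⁻¹) (f : F) :
    E f * (c • extE Γ F E x) = (s f : k) • ((c • extE Γ F E x) * E f) := by
  rcases hc with rfl | ⟨hm, hs⟩
  · simp
  · rw [extE, dif_pos hm, mul_smul_comm, hr.e_e f ⟨x, hm⟩ (s f) (hs f), smul_mul_assoc, smul_comm]

theorem ext_smul (hr : Rels k Γ θ g χ N F ψ ξ α E V) (c : k) (x y : Γ) (s : Γ → kˣ)
    (hc : c = 0 ∨ ∃ hm : x ∈ F, ∀ f : F, s (f : Γ) = ψ f ⟨x, hm⟩ * (ψ ⟨x, hm⟩ f)⁻¹) :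
    extE Γ F E y * (c • extE Γ F E x) = (s y : k) • ((c • extE Γ F E x) * extE Γ F E y) := by
  by_cases hy : y ∈ F
  · have := e_smul hr c x (fun f => s (f : Γ)) hc ⟨y, hy⟩
    have h2 : extE Γ F E y = E ⟨y, hy⟩ := dif_pos hy
    rw [h2]
    exact this
  · have h2 : extE Γ F E y = 0 := dif_neg hy
    rw [h2]; simp

theorem extE_opD (s : Γ → k) (x : Γ) :
    extE Γ F (fun f => opD k (s (f : Γ)) (E f)) x = opD k (s x) (extE Γ F E x) := by
  unfold extE
  split_ifs with h
  · rfl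
  · ext u t; simp [opD_apply]

end Commute

section Step
variable {k Γ F ψ}
variable {n : ℕ} {g : Fin (n + 1) → Γ} {χ : Fin (n + 1) → (Γ →* kˣ)}
    {N : Fin (n + 1) → ℕ} {ξ : Fin (n + 1) → k} {α : Fin (n + 1) → Fin (n + 1) → k}

/-- the relations hold on the induced module -/
theorem step_rels (h : Good k Γ (n + 1) g χ N F ψ ξ α)
    {B : Type} [Ring B] [Algebra k B] {E : F → B} {V : Fin n → B}
    (hr : Rels k Γ n (fun i => g i.castSucc) (fun i => χ i.castSucc) (fun i => N i.castSucc) F ψ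
      (fun i => ξ i.castSucc) (fun i j => α i.castSucc j.castSucc) E V) :
    ∃ (c : B) (Q : Fin n → k) (d : Fin n → ℕ → k) (a : Fin n → B) (s : F → k)
      (E' : F → Module.End k (perM k (N (Fin.last n)) c))
      (V' : Fin (n + 1) → Module.End k (perM k (N (Fin.last n)) c)),
      Rels k Γ (n + 1) g χ N F ψ ξ α E' V' ∧ (∀ f, s f ≠ 0) ∧ (∀ i, Q i ≠ 0) ∧ (∀ i, d i 0 = 0) ∧
      (∀ f u t, (E' f u : ℕ → B) t = s f ^ t • (E f * (u : ℕ → B) t)) ∧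
      (∀ i u t, (V' (Fin.castSucc i) u : ℕ → B) t = Q i ^ t • (V i * (u : ℕ → B) t)
        + d i t • (a i * (u : ℕ → B) (t - 1))) ∧
      (∀ u t, (V' (Fin.last n) u : ℕ → B) t = (u : ℕ → B) (t + 1)) := by
  set L := Fin.last n with hL
  have hne : ∀ i : Fin n, i.castSucc ≠ L := fun i => (Fin.castSucc_lt_last i).ne
  let c : B := ξ L • extE Γ F E (g L ^ N L)
  let Q : Fin n → k := fun i => (χ i.castSucc (g L) : k)
  let a : Fin n → B := fun i => α i.castSucc L • extE Γ F E (g i.castSucc * g L)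
  let p : k := (χ L (g L) : k)⁻¹
  let S : Γ → k := fun x => (χ L x : k)⁻¹
  -- scalar facts
  have hNL := h.hN1 L
  have hordk : ∀ i, orderOf (χ i (g i) : k) = N i := fun i => by
    rw [h.hN i]; exact orderOf_units
  have hpow : ∀ i, (χ i (g i) : k) ^ N i = 1 := fun i => by
    rw [← hordk i, pow_orderOf_eq_one]
  have hpm : p ^ N L = 1 := by simp only [p]; rw [inv_pow, hpow, inv_one]
  have hp1 : p ≠ 1 := by
    intro hh
    have h1 : (χ L (g L) : k) = 1 := by simpa [p] using hh
    have h2 := hordk L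
    rw [h1, orderOf_one] at h2
    omega
  have hcomp : ∀ i j, i ≠ j → (χ i (g j) : k) * (χ j (g i) : k) = 1 := fun i j hij => by
    rw [← Units.val_mul, h.compat i j hij, Units.val_one]
  have hχm : ∀ i x y, (χ i (x * y) : k) = (χ i x : k) * (χ i y : k) := fun i x y => by
    rw [map_mul, Units.val_mul]
  have hχp : ∀ i x m, (χ i (x ^ m) : k) = (χ i x : k) ^ m := fun i x y => by
    rw [map_pow, Units.val_pow_eq_pow_val]
  have hS : ∀ x, S x * (χ L x : k) = 1 := fun x => inv_mul_cancel₀ (Units.ne_zero _)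
  have hQS : ∀ i : Fin n, S (g i.castSucc) = Q i := fun i => by
    simp only [S, Q]
    exact inv_eq_of_mul_eq_one_left (hcomp _ _ (hne i))
  have hSm : ∀ x y, S (x * y) = S x * S y := fun x y => by
    simp only [S]; rw [hχm, mul_inv]
  have hSp : ∀ x m, S (x ^ m) = S x ^ m := fun x m => by
    simp only [S]; rw [hχp, inv_pow]
  -- commutation facts
  have hav : ∀ i j, a i * V j = ((χ j.castSucc (g i.castSucc) : k) * Q j) • (V j * a i) := by
    intro i j
    simp only [a, smul_mul_assoc, mul_smul_comm, Q]
    rw [hr.ext_v, hχm, smul_comm]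
  have hea : ∀ (f : F) i, E f * a i =
      ((χ i.castSucc (f : Γ) : k) * (χ L (f : Γ) : k)) • (a i * E f) := by
    intro f i
    have := e_smul hr (α i.castSucc L) (g i.castSucc * g L)
      (fun f => χ i.castSucc (f : Γ) * χ L (f : Γ)) (h.hα _ _ (Fin.castSucc_lt_last i)) f
    simpa only [Units.val_mul] using this
  have hxa : ∀ (x : Γ) i, extE Γ F E x * a i =
      ((χ i.castSucc x : k) * (χ L x : k)) • (a i * extE Γ F E x) := by
    intro x i
    have := ext_smul hr (α i.castSucc L) (g i.castSucc * g L) x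
      (fun x => χ i.castSucc x * χ L x) (h.hα _ _ (Fin.castSucc_lt_last i))
    simpa only [Units.val_mul] using this
  have hec : ∀ f : F, E f * c = ((χ L (f : Γ) : k) ^ N L) • (c * E f) := by
    intro f
    have := e_smul hr (ξ L) (g L ^ N L) (fun f => χ L (f : Γ) ^ N L) (h.hξ L) f
    simpa only [Units.val_pow_eq_pow_val] using this
  have hcv : ∀ j, c * V j = (Q j ^ N L) • (V j * c) := by
    intro j
    simp only [c, smul_mul_assoc, mul_smul_comm, Q]
    rw [hr.ext_v, hχp, smul_comm]
  have hca : ∀ j, c * a j = (Q j ^ N L) • (a j * c) := by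
    intro j
    have := hxa (g L ^ N L) j
    rw [hχp, hχp, hpow, mul_one] at this
    simp only [c, smul_mul_assoc, mul_smul_comm]
    rw [this, smul_comm]
  have hQ0 : ∀ i, Q i ≠ 0 := fun i => Units.ne_zero _
  have flip : ∀ (s : k) (x y : B), s ≠ 0 → x = s • y → y = s⁻¹ • x := by
    rintro s x y hs rfl
    rw [smul_smul, inv_mul_cancel₀ hs, one_smul]
  have hα2 : ∀ i j : Fin n, i ≠ j → a i = 0 ∨ a j = 0 ∨ ∀ t, br k p (t + 1) * br k p t = 0 := by
    intro i j hij
    by_cases hi : α i.castSucc L = 0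
    · left; simp [a, hi]
    by_cases hj : α j.castSucc L = 0
    · right; left; simp [a, hj]
    right; right
    obtain ⟨hmi, hi'⟩ := (h.hα _ _ (Fin.castSucc_lt_last i)).resolve_left hi
    obtain ⟨hmj, hj'⟩ := (h.hα _ _ (Fin.castSucc_lt_last j)).resolve_left hj
    have h1 := hi' ⟨_, hmj⟩
    have h2 := hj' ⟨_, hmi⟩
    have h3 : χ L (g L) * χ L (g L) = 1 := by
      have e1 := h.compat _ _ (hne i)
      have e2 := h.compat _ _ (hne j)
      have e3 := h.compat i.castSucc j.castSucc (by simpa using hij)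
      have e4 : (χ i.castSucc (g j.castSucc * g L) * χ L (g j.castSucc * g L)) *
          (χ j.castSucc (g i.castSucc * g L) * χ L (g i.castSucc * g L)) = 1 := by
        rw [h1, h2, mul_mul_mul_comm, mul_comm (ψ _ _) (ψ _ _), mul_mul_mul_comm,
          mul_inv_cancel, mul_inv_cancel, one_mul]
      simp only [map_mul] at e4
      calc χ L (g L) * χ L (g L) = (χ i.castSucc (g L) * χ L (g i.castSucc)) *
            (χ j.castSucc (g L) * χ L (g j.castSucc)) *
            (χ i.castSucc (g j.castSucc) * χ j.castSucc (g i.castSucc)) *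
            (χ L (g L) * χ L (g L)) := by rw [e1, e2, e3]; simp
        _ = _ := by rw [← e4]; simp only [mul_comm, mul_left_comm]
    have hp2 : p ^ 2 = 1 := by
      simp only [p]
      rw [inv_pow, sq, ← Units.val_mul, h3]; simp
    intro t
    rcases Nat.mod_two_eq_zero_or_one t with ht | ht
    · rw [br_mod k p hp1 2 hp2 t ht, mul_zero]
    · rw [br_mod k p hp1 2 hp2 (t + 1) (by omega), zero_mul]
  have hα1 : ∀ i : Fin n, a i = 0 ∨ ∀ t, t % N i.castSucc = 0 → br k p t = 0 := by
    intro i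
    by_cases hi : α i.castSucc L = 0
    · left; simp [a, hi]
    right
    obtain ⟨hmi, hi'⟩ := (h.hα _ _ (Fin.castSucc_lt_last i)).resolve_left hi
    have h1 := hi' ⟨_, hmi⟩
    rw [mul_inv_cancel] at h1
    simp only [map_mul] at h1
    have e1 := h.compat _ _ (hne i)
    have h2 : χ i.castSucc (g i.castSucc) = (χ L (g L))⁻¹ := by
      rw [eq_inv_iff_mul_eq_one]
      calc _ = (χ i.castSucc (g i.castSucc) * χ L (g L)) * 
          (χ i.castSucc (g L) * χ L (g i.castSucc)) := by rw [e1, mul_one]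
        _ = 1 := by rw [← h1, ← hL]; simp only [mul_comm, mul_left_comm]
    have h3 : N i.castSucc = N L := by rw [h.hN, h.hN, h2, orderOf_inv]
    intro t ht
    exact br_mod k p hp1 (N L) hpm t (by rw [← h3]; exact ht)
  -- operators
  let Eo : F → Module.End k (ℕ → B) := fun f => opD k (S (f : Γ)) (E f)
  let d : Fin n → ℕ → k := fun i t => -Q i ^ t * br k p t
  let Vo : Fin n → Module.End k (ℕ → B) := fun i => opD k (Q i) (V i) + opS k (d i) (a i)
  have hEo : ∀ f, ∀ u ∈ perM k (N L) c, Eo f u ∈ perM k (N L) c := fun f =>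
    opD_per k _ _ _ _ _ (by rw [← mul_pow, hS, one_pow]) (hec f)
  have hQinv : ∀ i, Q i ^ N L * (Q i ^ N L)⁻¹ = 1 := fun i =>
    mul_inv_cancel₀ (pow_ne_zero _ (hQ0 i))
  have hVo : ∀ i, ∀ u ∈ perM k (N L) c, Vo i u ∈ perM k (N L) c := fun i u hu =>
    Submodule.add_mem _
      (opD_per k _ _ _ _ _ (hQinv i) (flip _ _ _ (pow_ne_zero _ (hQ0 i)) (hcv i)) u hu)
      (opS_per k _ _ _ _ _ hp1 hpm _ (hQinv i) (flip _ _ _ (pow_ne_zero _ (hQ0 i)) (hca i)) u hu)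
  have hTo := opT_per k (B := B) (N L) c
  let E' : F → Module.End k (perM k (N L) c) := fun f => (Eo f).restrict (hEo f)
  let V' : Fin (n + 1) → Module.End k (perM k (N L) c) :=
    Fin.lastCases ((opT k).restrict hTo) (fun i => (Vo i).restrict (hVo i))
  have hVc : ∀ i : Fin n, V' i.castSucc = (Vo i).restrict (hVo i) := fun i => by
    simp only [V', Fin.lastCases_castSucc]
  have hVl : V' L = (opT k).restrict hTo := by
    simp only [V', hL, Fin.lastCases_last]
  have hE'ext : ∀ x (u : perM k (N L) c), ((extE Γ F E' x u : perM k (N L) c) : ℕ → B) =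
      opD k (S x) (extE Γ F E x) (u : ℕ → B) := by
    intro x u
    unfold extE
    split_ifs with hx
    · rfl
    · ext t; simp [opD_apply]
  refine ⟨c, Q, d, a, fun f => S (f : Γ), E', V', ?_, fun f => inv_ne_zero (Units.ne_zero _),
    hQ0, fun i => by simp [d, br_zero], fun f u t => rfl, fun i u t => ?_, fun u t => ?_⟩
  rotate_left
  · rw [hVc]; rfl
  · rw [hVl]; rfl
  constructor
  · ext u t
    simp [E', Eo, opD_apply, hr.e_one, S]
  · intro f f'
    have := opD_mul k (S (f : Γ)) (S (f' : Γ)) (ψ f f') (E f) (E f') (E (f * f')) (hr.e_mul f f')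
    rw [← hSm] at this
    ext u : 2
    exact congrArg (fun T => T (u : ℕ → B)) this
  · intro f i
    induction i using Fin.lastCases with
    | last =>
      rw [← hL, hVl]
      have := op_eT k (S (f : Γ)) (χ L (f : Γ)) (E f) (hS _)
      ext u : 2
      exact congrArg (fun T => T (u : ℕ → B)) this
    | cast i =>
      rw [hVc]
      have := op_ev k (S (f : Γ)) (χ L (f : Γ)) (Q i) (χ i.castSucc (f : Γ)) (E f) (V i) (a i) (d i)
        (hS _) (by simp [d, br_zero]) (hr.e_v f i) (hea f i)
      ext u : 2
      exact congrArg (fun T => T (u : ℕ → B)) this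
  · intro i j hij
    induction i using Fin.lastCases with
    | last => exact absurd hij (not_lt.2 (Fin.le_last _))
    | cast i =>
    induction j using Fin.lastCases with
    | last =>
      rw [← hL, hVl, hVc]
      have := op_vT k (χ L (g i.castSucc)) (Q i) p (V i) (a i)
        (by rw [mul_comm]; exact hcomp _ _ (hne i))
      have h2 : Q i * p = S (g i.castSucc * g L) := by rw [hSm, hQS]
      rw [h2] at this
      ext u : 2
      refine (congrArg (fun T => T (u : ℕ → B)) this).trans ?_
      rw [LinearMap.smul_apply, Submodule.coe_smul, hE'ext]
      ext t
      simp only [Pi.smul_apply, opD_apply, a, smul_mul_assoc]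
      rw [smul_comm]
    | cast j =>
      have hij' : i < j := by simpa using hij
      have hb := hα2 i j hij'.ne
      rw [hVc, hVc]
      have := op_vv k (χ j.castSucc (g i.castSucc)) (χ i.castSucc (g j.castSucc)) (Q i) (Q j) p
        (V i) (V j) (a i) (a j) _ (hcomp _ _ hij.ne') (hr.v_comm i j hij') (hav j i) (hav i j)
        (by intro t; rcases hb with hb | hb | hb <;> simp [hb])
        (by intro t; rcases hb with hb | hb | hb <;> simp [hb])
      have h2 : Q i * Q j = S (g i.castSucc * g j.castSucc) := by rw [hSm, hQS, hQS]
      rw [h2] at this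
      ext u : 2
      refine (congrArg (fun T => T (u : ℕ → B)) this).trans ?_
      rw [LinearMap.smul_apply, Submodule.coe_smul, hE'ext]
      ext t
      simp only [Pi.smul_apply, opD_apply, smul_mul_assoc]
      rw [smul_comm]
  · intro i
    induction i using Fin.lastCases with
    | last =>
      rw [← hL, hVl, Module.End.pow_restrict]
      ext u t
      rw [LinearMap.smul_apply, Submodule.coe_smul, hE'ext, LinearMap.coe_restrict_apply, opT_pow,
        u.2 t, Pi.smul_apply, opD_apply, hSp]
      have : S (g L) ^ N L = 1 := hpm
      rw [this, one_pow, one_smul]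
      simp only [c, smul_mul_assoc]
    | cast i =>
      rw [hVc, Module.End.pow_restrict]
      have := op_vpow k (χ i.castSucc (g i.castSucc)) (Q i) p (V i) (a i) (N i.castSucc)
        (by have := h.hN1 i.castSucc; omega) (hordk _) (hav i i) (hα1 i)
      rw [hr.v_pow i, ← hQS, ← hSp] at this
      ext u : 2
      rw [LinearMap.coe_restrict_apply, LinearMap.smul_apply, Submodule.coe_smul, hE'ext]
      have h3 := congrArg (fun T => T (u : ℕ → B)) this
      simp only [hQS] at h3
      refine h3.trans ?_
      ext t
      simp only [Pi.smul_apply, opD_apply, smul_mul_assoc]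
      rw [smul_comm]

end Step

theorem finite_of_span (h : Submodule.span k (Set.range (mono k Γ θ g χ N F ψ ξ α)) = ⊤) :
    Module.Finite k Aa := by
  refine ⟨?_⟩
  rw [← h]
  exact Submodule.fg_span (Set.finite_range _)

theorem rank_zero (g : Fin 0 → Γ) (χ : Fin 0 → (Γ →* kˣ))
    (N : Fin 0 → ℕ) (ξ : Fin 0 → k) (α : Fin 0 → Fin 0 → k)
    (h : Good k Γ 0 g χ N F ψ ξ α) :
    Nat.card F ≤ Module.finrank k (A k Γ 0 g χ N F ψ ξ α) := by
  classical
  have := finite_of_span k Γ 0 g χ N F ψ ξ α (span_zero k Γ F ψ g χ N ξ α)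
  let E' : F → Module.End k (F → k) := fun f =>
    { toFun := fun u x => (ψ x f : k) * u (x * f)
      map_add' := fun u w => by ext x; simp [mul_add]
      map_smul' := fun r u => by ext x; simp [mul_left_comm] }
  have hE : ∀ f u x, E' f u x = (ψ x f : k) * u (x * f) := fun _ _ _ => rfl
  have hr : Rels k Γ 0 g χ N F ψ ξ α E' (fun i => i.elim0) := by
    refine ⟨?_, ?_, fun _ i => i.elim0, fun i => i.elim0, fun i => i.elim0⟩
    · refine LinearMap.ext fun u => ?_
      ext x
      rw [hE]
      simp [h.hψ1']
    · intro f f'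
      refine LinearMap.ext fun u => ?_
      ext x
      have := congrArg (fun z : kˣ => (z : k)) (h.hψ x f f')
      simp only [Units.val_mul] at this
      rw [Module.End.mul_apply, hE, hE, LinearMap.smul_apply, Pi.smul_apply, hE, smul_eq_mul,
        ← mul_assoc, this, mul_assoc, mul_assoc]
  obtain ⟨ρ, hρ, -⟩ := exists_lift k Γ 0 g χ N F ψ ξ α E' _ hr
  let φ : A k Γ 0 g χ N F ψ ξ α →ₗ[k] (F → k) :=
    (LinearMap.applyₗ (Pi.single 1 1 : F → k)).comp ρ.toLinearMap
  have hφ : ∀ a, φ a = ρ a (Pi.single 1 1) := fun _ => rfl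
  have hs : Function.Surjective φ := by
    rw [← LinearMap.range_eq_top, eq_top_iff]
    intro w _
    rw [← Finset.univ_sum_single w]
    refine Submodule.sum_mem _ fun x _ => ?_
    refine ⟨((ψ x x⁻¹ : k)⁻¹ * w x) • e k Γ 0 g χ N F ψ ξ α x⁻¹, ?_⟩
    rw [map_smul, hφ, hρ]
    ext y
    rw [Pi.smul_apply, hE, smul_eq_mul]
    by_cases hy : y = x
    · subst hy
      simp only [mul_inv_cancel, Pi.single_eq_same, mul_one]
      rw [mul_right_comm, inv_mul_cancel₀ (Units.ne_zero _), one_mul]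
    · have : y * x⁻¹ ≠ 1 := by rwa [Ne, mul_inv_eq_one]
      rw [Pi.single_eq_of_ne hy, Pi.single_eq_of_ne this]; simp
  have := LinearMap.finrank_le_finrank_of_surjective hs
  rwa [Module.finrank_fintype_fun_eq_card, ← Nat.card_eq_fintype_card] at this

theorem step_surj (n : ℕ) (g : Fin (n + 1) → Γ) (χ : Fin (n + 1) → (Γ →* kˣ))
    (N : Fin (n + 1) → ℕ) (ξ : Fin (n + 1) → k) (α : Fin (n + 1) → Fin (n + 1) → k)
    (h : Good k Γ (n + 1) g χ N F ψ ξ α)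
    {B : Type} [Ring B] [Algebra k B] {E : F → B} {V : Fin n → B}
    (hr : Rels k Γ n (fun i => g i.castSucc) (fun i => χ i.castSucc) (fun i => N i.castSucc) F ψ
      (fun i => ξ i.castSucc) (fun i j => α i.castSucc j.castSucc) E V)
    (htop : ∀ W : Submodule k B, (1 : B) ∈ W → (∀ f, ∀ w ∈ W, E f * w ∈ W) →
      (∀ i, ∀ w ∈ W, V i * w ∈ W) → W = ⊤) :
    ∃ φ : A k Γ (n + 1) g χ N F ψ ξ α →ₗ[k] (Fin (N (Fin.last n)) → B),
      Function.Surjective φ := by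
  classical
  obtain ⟨c, Q, d, a, s, E', V', hr, hs0, hQ0, hd0, hE, hV, hT⟩ := step_rels h hr
  obtain ⟨ρ, hρe, hρv⟩ := exists_lift k Γ (n + 1) g χ N F ψ ξ α E' V' hr
  have hN1 := h.hN1 (Fin.last n)
  let u0 : perM k (N (Fin.last n)) c := ⟨fun t => if t % N (Fin.last n) = N (Fin.last n) - 1 then c ^ (t / N (Fin.last n)) else 0, by
    intro t
    simp only [Nat.add_mod_right]
    rw [Nat.add_div_right _ (by omega)]
    split_ifs
    · rw [pow_succ']
    · simp⟩
  have base : ∀ b : B, ∃ x, ∀ t < N (Fin.last n), (ρ x u0 : ℕ → B) t = if t = N (Fin.last n) - 1 then b else 0 := by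
    let W : Submodule k B :=
      { carrier := {b | ∃ x, ∀ t < N (Fin.last n), (ρ x u0 : ℕ → B) t = if t = N (Fin.last n) - 1 then b else 0}
        zero_mem' := ⟨0, fun t _ => by simp⟩
        add_mem' := by
          rintro b b' ⟨x, hx⟩ ⟨y, hy⟩
          refine ⟨x + y, fun t ht => ?_⟩
          rw [map_add, LinearMap.add_apply, Submodule.coe_add, Pi.add_apply, hx t ht, hy t ht]
          split_ifs <;> simp
        smul_mem' := by
          rintro r b ⟨x, hx⟩
          refine ⟨r • x, fun t ht => ?_⟩
          rw [map_smul, LinearMap.smul_apply, Submodule.coe_smul, Pi.smul_apply, hx t ht]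
          split_ifs <;> simp }
    have hsm : ∀ (r : k) (b : B), r ≠ 0 → r • b ∈ W → b ∈ W := by
      intro r b hr0 hb
      have := W.smul_mem r⁻¹ hb
      rwa [smul_smul, inv_mul_cancel₀ hr0, one_smul] at this
    have hW : W = ⊤ := by
      apply htop
      · refine ⟨1, fun t ht => ?_⟩
        rw [map_one, Module.End.one_apply]
        simp [u0, Nat.mod_eq_of_lt ht, Nat.div_eq_of_lt ht]
      · rintro f w ⟨x, hx⟩
        refine hsm (s f ^ (N (Fin.last n) - 1)) _ (pow_ne_zero _ (hs0 f))
          ⟨e k Γ (n + 1) g χ N F ψ ξ α f * x, fun t ht => ?_⟩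
        rw [map_mul, Module.End.mul_apply, hρe, hE, hx t ht]
        split_ifs with htm
        · rw [htm]
        · simp
      · rintro i w ⟨x, hx⟩
        refine hsm (Q i ^ (N (Fin.last n) - 1)) _ (pow_ne_zero _ (hQ0 i))
          ⟨v k Γ (n + 1) g χ N F ψ ξ α i.castSucc * x, fun t ht => ?_⟩
        rw [map_mul, Module.End.mul_apply, hρv, hV, hx t ht, hx (t - 1) (by omega),
          if_neg (show ¬ (t - 1 = N (Fin.last n) - 1) by omega), mul_zero, smul_zero, add_zero]
        split_ifs with htm
        · rw [htm]
        · simp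
    intro b
    have : b ∈ W := by rw [hW]; trivial
    exact this
  have all : ∀ r < N (Fin.last n), ∀ b : B, ∃ x, ∀ t < N (Fin.last n), (ρ x u0 : ℕ → B) t = if t = N (Fin.last n) - 1 - r then b else 0 := by
    intro r
    induction r with
    | zero => intro _ b; simpa using base b
    | succ r ih =>
      intro hrm b
      obtain ⟨x, hx⟩ := ih (by omega) b
      refine ⟨v k Γ (n + 1) g χ N F ψ ξ α (Fin.last n) * x, fun t ht => ?_⟩
      rw [map_mul, Module.End.mul_apply, hρv, hT]
      by_cases htm : t + 1 < N (Fin.last n)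
      · rw [hx _ htm]
        congr 1
        apply propext; omega
      · have ht1 : t + 1 = 0 + N (Fin.last n) := by omega
        rw [ht1, (ρ x u0).2 0, hx 0 (by omega), if_neg (by omega), if_neg (by omega), mul_zero]
  let φ : A k Γ (n + 1) g χ N F ψ ξ α →ₗ[k] (Fin (N (Fin.last n)) → B) :=
    { toFun := fun x t => (ρ x u0 : ℕ → B) t
      map_add' := fun x y => by ext t; simp
      map_smul' := fun r x => by ext t; simp }
  have hφ : ∀ x t, φ x t = (ρ x u0 : ℕ → B) t := fun _ _ => rfl
  have hs : Function.Surjective φ := by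
    rw [← LinearMap.range_eq_top, eq_top_iff]
    intro w _
    rw [← Finset.univ_sum_single w]
    refine Submodule.sum_mem _ fun t _ => ?_
    obtain ⟨x, hx⟩ := all (N (Fin.last n) - 1 - t) (by omega) (w t)
    refine ⟨x, ?_⟩
    ext t'
    rw [hφ, hx t' t'.2]
    have ht := t.2
    by_cases htt : t' = t
    · subst htt
      rw [Pi.single_eq_same, if_pos (by omega)]
    · rw [Pi.single_eq_of_ne htt, if_neg]
      intro hh
      exact htt (Fin.ext (by omega))
  exact ⟨φ, hs⟩

theorem rank_succ (n : ℕ) (g : Fin (n + 1) → Γ) (χ : Fin (n + 1) → (Γ →* kˣ))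
    (N : Fin (n + 1) → ℕ) (ξ : Fin (n + 1) → k) (α : Fin (n + 1) → Fin (n + 1) → k)
    (h : Good k Γ (n + 1) g χ N F ψ ξ α)
    (hsp : Submodule.span k (Set.range (mono k Γ (n + 1) g χ N F ψ ξ α)) = ⊤) 
    (hsp' : Submodule.span k (Set.range (mono k Γ n (fun i => g i.castSucc) (fun i => χ i.castSucc)
      (fun i => N i.castSucc) F ψ (fun i => ξ i.castSucc)
      (fun i j => α i.castSucc j.castSucc))) = ⊤) :
    N (Fin.last n) * Module.finrank k (A k Γ n (fun i => g i.castSucc) (fun i => χ i.castSucc)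
      (fun i => N i.castSucc) F ψ (fun i => ξ i.castSucc)
      (fun i j => α i.castSucc j.castSucc)) ≤ Module.finrank k (A k Γ (n + 1) g χ N F ψ ξ α) := by
  classical
  have := finite_of_span k Γ _ _ _ _ F ψ _ _ hsp
  have := finite_of_span k Γ _ _ _ _ F ψ _ _ hsp'
  obtain ⟨φ, hs⟩ := step_surj k Γ F ψ n g χ N ξ α h
    (A_rels k Γ n (fun i => g i.castSucc) (fun i => χ i.castSucc)
      (fun i => N i.castSucc) F ψ (fun i => ξ i.castSucc) (fun i j => α i.castSucc j.castSucc))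
    (left_ideal_top k Γ n _ _ _ F ψ _ _)
  have := LinearMap.finrank_le_finrank_of_surjective hs
  rwa [Module.finrank_pi_fintype, Finset.sum_const, Finset.card_univ, Fintype.card_fin,
    smul_eq_mul] at this

theorem main_aux : ∀ (θ : ℕ) (g : Fin θ → Γ) (χ : Fin θ → (Γ →* kˣ))
    (N : Fin θ → ℕ) (ξ : Fin θ → k) (α : Fin θ → Fin θ → k),
    Good k Γ θ g χ N F ψ ξ α →
    Submodule.span k (Set.range (mono k Γ θ g χ N F ψ ξ α)) = ⊤ ∧
    Nat.card F * ∏ i, N i ≤ Module.finrank k (A k Γ θ g χ N F ψ ξ α) := by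
  intro θ
  induction θ with
  | zero =>
    intro g χ N ξ α h
    exact ⟨span_zero k Γ F ψ g χ N ξ α, by simpa using rank_zero k Γ F ψ g χ N ξ α h⟩
  | succ n ih =>
    intro g χ N ξ α h
    obtain ⟨h1, h2⟩ := ih _ _ _ _ _ h.castSucc
    have h3 := span_succ k Γ F ψ n g χ N ξ α h h1
    refine ⟨h3, le_trans ?_ (rank_succ k Γ F ψ n g χ N ξ α h h3 h1)⟩
    rw [Fin.prod_univ_castSucc, ← mul_assoc, mul_comm]
    exact Nat.mul_le_mul_left _ h2

end Helpers

/-- The elements `e_f · v_1^{r_1} ⋯ v_θ^{r_θ}` with `f ∈ F`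
and `0 ≤ r_i < N_i` form a `k`-basis of `A(V,F,ψ,ξ,α)`; in particular
`dim_k A(V,F,ψ,ξ,α) = |F| · N_1 ⋯ N_θ`. -/
theorem basis_of_comodule_algebra
    (hθ : 1 ≤ θ)
    (hq : ∀ i, χ i (g i) ≠ 1)
    (hcompat : ∀ i j, i ≠ j → χ i (g j) * χ j (g i) = 1)
    (hN : ∀ i, N i = orderOf (χ i (g i))) (hN1 : ∀ i, 1 < N i)
    -- `ψ` is a normalized 2-cocycle on `F`:
    (hψ : ∀ x y z : F, ψ x y * ψ (x * y) z = ψ y z * ψ x (y * z))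
    (hψ1 : ∀ x : F, ψ 1 x = 1) (hψ1' : ∀ x : F, ψ x 1 = 1)
    -- `(ξ, α)` is a compatible comodule algebra datum:
    (hξ : ∀ i, ξ i = 0 ∨ ∃ hmem : g i ^ N i ∈ F,
      ∀ f : F, (χ i (f : Γ)) ^ N i =
        ψ f ⟨g i ^ N i, hmem⟩ * (ψ ⟨g i ^ N i, hmem⟩ f)⁻¹)
    (hα : ∀ i j : Fin θ, i < j → (α i j = 0 ∨ ∃ hmem : g i * g j ∈ F,
      ∀ f : F, χ i (f : Γ) * χ j (f : Γ) =
        ψ f ⟨g i * g j, hmem⟩ * (ψ ⟨g i * g j, hmem⟩ f)⁻¹)) :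
    LinearIndependent k
      (fun p : F × (∀ i : Fin θ, Fin (N i)) =>
        ee p.1 * ((List.finRange θ).map fun i => vv i ^ (p.2 i : ℕ)).prod) ∧
    Submodule.span k
      (Set.range fun p : F × (∀ i : Fin θ, Fin (N i)) =>
        ee p.1 * ((List.finRange θ).map fun i => vv i ^ (p.2 i : ℕ)).prod) = ⊤ ∧
    Module.finrank k Aa = Nat.card F * ∏ i : Fin θ, N i := by
  have h : Good k Γ θ g χ N F ψ ξ α := ⟨hcompat, hN, hN1, hψ, hψ1, hψ1', hξ, hα⟩
  obtain ⟨hs, hd⟩ := main_aux k Γ F ψ θ g χ N ξ α h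
  have hfin := finite_of_span k Γ θ g χ N F ψ ξ α hs
  have := Fintype.ofFinite F
  have hcard : Fintype.card (F × (∀ i : Fin θ, Fin (N i))) = Nat.card F * ∏ i, N i := by
    simp [Fintype.card_prod, Fintype.card_pi, Nat.card_eq_fintype_card]
  have hli : LinearIndependent k (mono k Γ θ g χ N F ψ ξ α) :=
    linearIndependent_of_top_le_span_of_card_le_finrank hs.ge (by rw [hcard]; exact hd)
  refine ⟨hli, hs, ?_⟩
  rw [← hcard]
  exact Module.finrank_eq_card_basis (Module.Basis.mk hli hs.ge)

end QLSBasis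

end
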